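/- (Forward inclusion in the proof of Theorems 1 and 2) Every point of S lies in S_QC; that is, for every (z, x₁, x₂, x₃, x₄) in the convex hull of the 16 points {(φ(γ), γ) : γ a vertex of B}, there exist λᶜ, λˢ ∈ Δ₈ realizing the extreme-point representation of (z, x₁, x₂, x₃, x₄) and satisfying the linking constraint. Hence S ⊆ S_QC. -/

import Mathlib

open Finset Real

noncomputable section

/-- Vertices of the box `[l1,u1] × [l2,u2] × [l3,u3]` in lexicographic order. -/
def xiC (l1 u1 l2 u2 l3 u3 : ℝ) : Fin 8 → ℝ × ℝ × ℝ :=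
  ![(l1, l2, l3), (l1, l2, u3), (l1, u2, l3), (l1, u2, u3),
    (u1, l2, l3), (u1, l2, u3), (u1, u2, l3), (u1, u2, u3)]

/-- The trilinear product of the coordinates of a point of `ℝ³`. -/
def tri (p : ℝ × ℝ × ℝ) : ℝ := p.1 * p.2.1 * p.2.2

/-- The linking constraint between the multipliers `lc` and `ls`. -/
def Linking (l1 u1 l2 u2 : ℝ) (lc ls : Fin 8 → ℝ) : Prop :=
    (lc 0 + lc 1 - ls 0 - ls 1) * (l1 * l2)
  + (lc 2 + lc 3 - ls 2 - ls 3) * (l1 * u2)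
  + (lc 4 + lc 5 - ls 4 - ls 5) * (u1 * l2)
  + (lc 6 + lc 7 - ls 6 - ls 7) * (u1 * u2) = 0

/-- The sum of two trilinear terms sharing the first two variables. -/
def phi (ac as : ℝ) (x : ℝ × ℝ × ℝ × ℝ) : ℝ :=
  ac * (x.1 * x.2.1 * x.2.2.1) + as * (x.1 * x.2.1 * x.2.2.2)

/-- The box `B = [l1,u1] × [l2,u2] × [l3,u3] × [l4,u4] ⊆ ℝ⁴`. -/
def boxB (l1 u1 l2 u2 l3 u3 l4 u4 : ℝ) : Set (ℝ × ℝ × ℝ × ℝ) :=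
  {x | x.1 ∈ Set.Icc l1 u1 ∧ x.2.1 ∈ Set.Icc l2 u2 ∧
       x.2.2.1 ∈ Set.Icc l3 u3 ∧ x.2.2.2 ∈ Set.Icc l4 u4}

/-- The set of vertices of the box `B`. -/
def vertB (l1 u1 l2 u2 l3 u3 l4 u4 : ℝ) : Set (ℝ × ℝ × ℝ × ℝ) :=
  {x | (x.1 = l1 ∨ x.1 = u1) ∧ (x.2.1 = l2 ∨ x.2.1 = u2) ∧
       (x.2.2.1 = l3 ∨ x.2.2.1 = u3) ∧ (x.2.2.2 = l4 ∨ x.2.2.2 = u4)}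

/-- The strengthened (TLM) relaxation set `S_QC ⊆ ℝ⁵`. -/
def SQC (l1 u1 l2 u2 l3 u3 l4 u4 ac as : ℝ) : Set (ℝ × ℝ × ℝ × ℝ × ℝ) :=
  {p | ∃ lc ls : Fin 8 → ℝ,
    lc ∈ stdSimplex ℝ (Fin 8) ∧ ls ∈ stdSimplex ℝ (Fin 8) ∧
    (p.2.1, p.2.2.1, p.2.2.2.1) = ∑ k, lc k • xiC l1 u1 l2 u2 l3 u3 k ∧
    (p.2.1, p.2.2.1, p.2.2.2.2) = ∑ k, ls k • xiC l1 u1 l2 u2 l4 u4 k ∧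
    p.1 = ac * ∑ k, lc k * tri (xiC l1 u1 l2 u2 l3 u3 k)
        + as * ∑ k, ls k * tri (xiC l1 u1 l2 u2 l4 u4 k) ∧
    Linking l1 u1 l2 u2 lc ls}

/-- `S`: the convex hull of the 16 points `(φ(γ), γ)`, `γ` a vertex of `B`. -/
def Shull (l1 u1 l2 u2 l3 u3 l4 u4 ac as : ℝ) : Set (ℝ × ℝ × ℝ × ℝ × ℝ) :=
  convexHull ℝ ((fun x => (phi ac as x, x)) '' vertB l1 u1 l2 u2 l3 u3 l4 u4)

/-- The linking constraint says that both families of multipliers represent the same value of the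
product of the first two coordinates. -/
theorem linking_iff_sum_eq (l1 u1 l2 u2 l3 u3 l4 u4 : ℝ) (lc ls : Fin 8 → ℝ) :
    Linking l1 u1 l2 u2 lc ls ↔
      ∑ k, lc k * ((xiC l1 u1 l2 u2 l3 u3 k).1 * (xiC l1 u1 l2 u2 l3 u3 k).2.1) =
        ∑ k, ls k * ((xiC l1 u1 l2 u2 l4 u4 k).1 * (xiC l1 u1 l2 u2 l4 u4 k).2.1) := by
  simp only [Linking, xiC, Fin.sum_univ_eight, Matrix.cons_val]
  constructor <;> intro h <;> linarith

/-- Every vertex of a three-dimensional box is listed by `xiC`. -/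
theorem exists_xiC_eq {l1 u1 l2 u2 l3 u3 a b c : ℝ} (ha : a = l1 ∨ a = u1)
    (hb : b = l2 ∨ b = u2) (hc : c = l3 ∨ c = u3) :
    ∃ k, xiC l1 u1 l2 u2 l3 u3 k = (a, b, c) := by
  rcases ha with rfl | rfl <;> rcases hb with rfl | rfl <;> rcases hc with rfl | rfl
  exacts [⟨0, rfl⟩, ⟨1, rfl⟩, ⟨2, rfl⟩, ⟨3, rfl⟩, ⟨4, rfl⟩, ⟨5, rfl⟩, ⟨6, rfl⟩, ⟨7, rfl⟩]

/-- The lifted vertices of the box belong to the relaxation. -/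
theorem phi_mem_SQC {l1 u1 l2 u2 l3 u3 l4 u4 : ℝ} (ac as : ℝ) {x : ℝ × ℝ × ℝ × ℝ}
    (hx : x ∈ vertB l1 u1 l2 u2 l3 u3 l4 u4) :
    (phi ac as x, x) ∈ SQC l1 u1 l2 u2 l3 u3 l4 u4 ac as := by
  obtain ⟨ha, hb, hc, hd⟩ := hx
  obtain ⟨i, hi⟩ := exists_xiC_eq ha hb hc
  obtain ⟨j, hj⟩ := exists_xiC_eq ha hb hd
  refine ⟨Pi.single i 1, Pi.single j 1, single_mem_stdSimplex ℝ i, single_mem_stdSimplex ℝ j,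
    ?_, ?_, ?_, (linking_iff_sum_eq l1 u1 l2 u2 l3 u3 l4 u4 _ _).2 ?_⟩ <;>
  simp [Pi.single_apply, ite_smul, hi, hj, tri, phi]

/-- The relaxation is convex. -/
theorem convex_SQC (l1 u1 l2 u2 l3 u3 l4 u4 ac as : ℝ) :
    Convex ℝ (SQC l1 u1 l2 u2 l3 u3 l4 u4 ac as) := by
  rintro p ⟨lc, ls, hlc, hls, hc, hs, hz, hl⟩ q ⟨mc, ms, hmc, hms, hc', hs', hz', hl'⟩ a b ha hb hab
  refine ⟨a • lc + b • mc, a • ls + b • ms, convex_stdSimplex ℝ _ hlc hmc ha hb hab,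
    convex_stdSimplex ℝ _ hls hms ha hb hab, ?_, ?_, ?_, ?_⟩
  · simp only [Pi.add_apply, Pi.smul_apply, add_smul, smul_assoc, sum_add_distrib, ← smul_sum,
      ← hc, ← hc']
    rfl
  · simp only [Pi.add_apply, Pi.smul_apply, add_smul, smul_assoc, sum_add_distrib, ← smul_sum,
      ← hs, ← hs']
    rfl
  · simp only [Pi.add_apply, Pi.smul_apply, Prod.fst_add, Prod.smul_fst, smul_eq_mul, add_mul,
      mul_assoc, sum_add_distrib, ← mul_sum, hz, hz']
    ring
  · simp only [Linking, Pi.add_apply, Pi.smul_apply, smul_eq_mul] at hl hl' ⊢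
    linear_combination a * hl + b * hl'

/-- forward inclusion: `S ⊆ S_QC`. -/
theorem Shull_subset_SQC (l1 u1 l2 u2 l3 u3 l4 u4 ac as : ℝ)
    (h1 : l1 ≤ u1) (h2 : l2 ≤ u2) (h3 : l3 ≤ u3) (h4 : l4 ≤ u4) :
    Shull l1 u1 l2 u2 l3 u3 l4 u4 ac as ⊆ SQC l1 u1 l2 u2 l3 u3 l4 u4 ac as := by
  refine convexHull_min ?_ (convex_SQC ..)
  rintro _ ⟨x, hx, rfl⟩
  exact phi_mem_SQC ac as hx
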